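/- arXiv:2412.13011 — 2 statements merged into one kernel-verified Lean document; each statement's English description precedes it below -/
import Mathlib

section
/- (Proposition 7, condition 1) Let H be a separable complex Hilbert space and let F = ∪_{k∈K} F_k be a trace-norm-closed set of free states written as a union (over an arbitrary, not necessarily countable, index set K) of sets F_k, each of which is closed and convex. Let ρ be a density operator with ρ ∉ F, and suppose R̲_F(ρ) = R_F(ρ). Then R̲_F(ρ) = inf_{k∈K} R̲_{F_k}(ρ). -/
open Filter Topology
open scoped ENNReal

/-- The generalized robustness `R_S(ρ)` (Definition 1). -/
noncomputable def genRob {T : Type*} [AddCommGroup T] [Module ℂ T]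
    (D S : Set T) (ρ : T) : ℝ≥0∞ :=
  sInf (ENNReal.ofReal ''
    {l : ℝ | 0 ≤ l ∧ ∃ τ ∈ D, (1 + (l : ℂ))⁻¹ • (ρ + (l : ℂ) • τ) ∈ S})

/-- The lower semi-continuous generalized robustness `R̲_S(ρ)` (Definition 2). -/
noncomputable def lscGenRob {T : Type*} [AddCommGroup T] [Module ℂ T]
    [TopologicalSpace T] (D S : Set T) (ρ : T) : ℝ≥0∞ :=
  sInf (ENNReal.ofReal ''
    {l : ℝ | 0 ≤ l ∧ ∃ ξ τ : ℕ → T, (∀ n, ξ n ∈ D) ∧ (∀ n, τ n ∈ D) ∧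
      Tendsto ξ atTop (𝓝 ρ) ∧
      ∀ n, (1 + (l : ℂ))⁻¹ • (ξ n + (l : ℂ) • τ n) ∈ S})

/-- The lower semi-continuous robustness is antitone in the free set. -/
theorem lscGenRob_anti {T : Type*} [AddCommGroup T] [Module ℂ T] [TopologicalSpace T]
    (D : Set T) {S S' : Set T} (h : S ⊆ S') (ρ : T) :
    lscGenRob D S' ρ ≤ lscGenRob D S ρ := by
  refine sInf_le_sInf (Set.image_mono ?_)
  rintro l ⟨hl, ξ, τ, hξ, hτ, hlim, hmem⟩
  exact ⟨hl, ξ, τ, hξ, hτ, hlim, fun n => h (hmem n)⟩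

/-- A single decomposition of `ρ` bounds the lower semi-continuous robustness,
by taking constant sequences. -/
theorem lscGenRob_le_ofReal {T : Type*} [AddCommGroup T] [Module ℂ T] [TopologicalSpace T]
    {D S : Set T} {ρ τ : T} {l : ℝ} (hρ : ρ ∈ D) (hτ : τ ∈ D) (hl : 0 ≤ l)
    (h : (1 + (l : ℂ))⁻¹ • (ρ + (l : ℂ) • τ) ∈ S) :
    lscGenRob D S ρ ≤ ENNReal.ofReal l :=
  sInf_le ⟨l, ⟨hl, fun _ => ρ, fun _ => τ, fun _ => hρ, fun _ => hτ,
    tendsto_const_nhds, fun _ => h⟩, rfl⟩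

/-- Proposition 7, condition 1.
`T` models the trace-class operators on a separable complex Hilbert space `H` with the
trace norm, and `D` the set of density operators.  Let `F = ⋃_{k∈K} F_k` be a
trace-norm-closed set of free states written as a union over an arbitrary (not
necessarily countable) index set `K` of closed convex sets `F_k`, and let `ρ ∈ D` with
`ρ ∉ F`.  If `R̲_F(ρ) = R_F(ρ)`, then `R̲_F(ρ) = ⨅_{k∈K} R̲_{F_k}(ρ)`. -/
theorem stmt_10
    {T : Type*} [NormedAddCommGroup T] [NormedSpace ℂ T]
    (D : Set T) {K : Type*} (Fk : K → Set T)
    (hFk_closed : ∀ k, IsClosed (Fk k)) (hFk_convex : ∀ k, Convex ℝ (Fk k))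
    (F : Set T) (hFunion : F = ⋃ k, Fk k) (hFD : F ⊆ D) (hFclosed : IsClosed F)
    (ρ : T) (hρ : ρ ∈ D) (hρF : ρ ∉ F)
    (hcond : lscGenRob D F ρ = genRob D F ρ) :
    lscGenRob D F ρ = ⨅ k, lscGenRob D (Fk k) ρ := by
  subst hFunion
  apply le_antisymm
  · exact le_iInf fun k => lscGenRob_anti D (Set.subset_iUnion Fk k) ρ
  · rw [hcond]
    refine le_sInf ?_
    rintro _ ⟨l, ⟨hl, τ, hτ, hmem⟩, rfl⟩
    obtain ⟨k, hk⟩ := Set.mem_iUnion.mp hmem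
    exact (iInf_le _ k).trans (lscGenRob_le_ofReal hρ hτ hl hk)
end

section
/- (Proposition 7, condition 2) Let H be a separable complex Hilbert space and let F = F_1 ∪ F_2 ∪ … ∪ F_N be a trace-norm-closed set of free states written as a FINITE union of sets F_k, each of which is closed and convex. Then for every density operator ρ with ρ ∉ F, the lower semi-continuous generalized robustness satisfies R̲_F(ρ) = min_{1≤k≤N} R̲_{F_k}(ρ). -/
open Filter Topology
open scoped ENNReal

/-- By the pigeonhole principle, a sequence in a finite union has a subsequence in one member. -/
theorem exists_subseq_mem_of_mem_iUnion {α ι : Type*} [Finite ι] {s : ι → Set α} {x : ℕ → α}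
    (h : ∀ n, x n ∈ ⋃ i, s i) : ∃ i, ∃ φ : ℕ → ℕ, StrictMono φ ∧ ∀ n, x (φ n) ∈ s i := by
  choose k hk using fun n => Set.mem_iUnion.mp (h n)
  obtain ⟨i, hi⟩ := Finite.exists_infinite_fiber k
  have hfreq : ∃ᶠ n in atTop, x n ∈ s i := by
    refine (Nat.frequently_atTop_iff_infinite.mpr (Set.infinite_coe_iff.mp hi)).mono ?_
    rintro n rfl
    exact hk n
  exact ⟨i, extraction_of_frequently_atTop hfreq⟩

theorem lscGenRob_iUnion {T ι : Type*} [AddCommGroup T] [Module ℂ T] [TopologicalSpace T]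
    [Finite ι] (D : Set T) (S : ι → Set T) (ρ : T) :
    lscGenRob D (⋃ i, S i) ρ = ⨅ i, lscGenRob D (S i) ρ := by
  refine le_antisymm (le_iInf fun i => lscGenRob_anti D (Set.subset_iUnion S i) ρ) ?_
  refine le_sInf ?_
  rintro _ ⟨l, ⟨hl, ξ, τ, hξ, hτ, hlim, hmem⟩, rfl⟩
  obtain ⟨i, φ, hφ, hi⟩ := exists_subseq_mem_of_mem_iUnion hmem
  exact iInf_le_of_le i (sInf_le ⟨l, ⟨hl, ξ ∘ φ, τ ∘ φ, fun n => hξ _, fun n => hτ _,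
    hlim.comp hφ.tendsto_atTop, hi⟩, rfl⟩)

/-- Proposition 7, condition 2.
`T` models the trace-class operators on a separable complex Hilbert space `H` with the
trace norm, and `D` the set of density operators.  Let `F = F_1 ∪ ⋯ ∪ F_N` be a
trace-norm-closed set of free states written as a finite union of closed convex sets
`F_k`.  Then for every density operator `ρ ∉ F`,
`R̲_F(ρ) = min_{1 ≤ k ≤ N} R̲_{F_k}(ρ)`. -/
theorem stmt_11
    {T : Type*} [NormedAddCommGroup T] [NormedSpace ℂ T]
    (D : Set T) (N : ℕ) (hN : 0 < N) (Fk : Fin N → Set T)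
    (hFk_closed : ∀ k, IsClosed (Fk k)) (hFk_convex : ∀ k, Convex ℝ (Fk k))
    (F : Set T) (hFunion : F = ⋃ k, Fk k) (hFD : F ⊆ D) (hFclosed : IsClosed F)
    (ρ : T) (hρ : ρ ∈ D) (hρF : ρ ∉ F) :
    lscGenRob D F ρ = ⨅ k : Fin N, lscGenRob D (Fk k) ρ := by
  subst hFunion
  exact lscGenRob_iUnion D Fk ρ
end
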